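/- arXiv:2504.06971 — 2 statements merged into one kernel-verified Lean document; each statement's English description precedes it below -/
import Mathlib

section
/- Let η ∈ (0,1/4) and m ∈ {0,…,n−2}. Then for every point p = (x̄_0, ȳ_0, t_0) ∈ D_{η,m} one has d_p(p, ∂D_{η,m}) ≤ min{|ȳ_0| − η|t_0|^{1/2}, |ȳ_0| − η|x̄_0|} ≤ (1+η) · d_p(p, ∂D_{η,m}), where d_p denotes the parabolic distance. -/
open Metric Set MeasureTheory Filter

noncomputable section

/-- The parabolic cylinder `Q_r(x₀,t₀) = B_r(x₀) × (t₀ - r², t₀)`. -/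
def pcylinder (n : ℕ) (r : ℝ) (x₀ : EuclideanSpace ℝ (Fin n)) (t₀ : ℝ) :
    Set (EuclideanSpace ℝ (Fin n) × ℝ) :=
  (Metric.ball x₀ r) ×ˢ (Set.Ioo (t₀ - r ^ 2) t₀)

/-- `Q_r = Q_r(0,0)`. -/
def Q (n : ℕ) (r : ℝ) : Set (EuclideanSpace ℝ (Fin n) × ℝ) :=
  pcylinder n r 0 0

/-- The spatial Laplacian of `u(·,t)` at `(x,t)`. -/
def slap {n : ℕ} (u : EuclideanSpace ℝ (Fin n) → ℝ → ℝ)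
    (x : EuclideanSpace ℝ (Fin n)) (t : ℝ) : ℝ :=
  ∑ i : Fin n,
    fderiv ℝ (fun y => fderiv ℝ (fun z => u z t) y (EuclideanSpace.single i (1:ℝ))) x
      (EuclideanSpace.single i (1:ℝ))

/-- The parabolic distance `d_p((x,t),(y,s)) = (|x-y|² + |t-s|)^{1/2}`. -/
def pdist {n : ℕ} (p q : EuclideanSpace ℝ (Fin n) × ℝ) : ℝ :=
  Real.sqrt (‖p.1 - q.1‖ ^ 2 + |p.2 - q.2|)

/-- `Ω_r = {p ∈ Ω : d_p(p, ∂Ω) ≥ r}`. -/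
def pint {n : ℕ} (Ω : Set (EuclideanSpace ℝ (Fin n) × ℝ)) (r : ℝ) :
    Set (EuclideanSpace ℝ (Fin n) × ℝ) :=
  {p ∈ Ω | ∀ q ∈ frontier Ω, r ≤ pdist p q}

/-- The natural `n`-dimensional surface measure on the parabolic boundary of the cylinder
`Q_r(x₀,t₀)`: Lebesgue measure on the bottom `B_r(x₀) × {t₀ - r²}` plus surface measure
(`(n-1)`-Hausdorff on the sphere times length in time) on the lateral boundary. -/
def pbSurfaceMeasureCyl (n : ℕ) (r : ℝ) (x₀ : EuclideanSpace ℝ (Fin n)) (t₀ : ℝ) :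
    Measure (EuclideanSpace ℝ (Fin n) × ℝ) :=
  Measure.map (fun x => (x, t₀ - r ^ 2)) (volume.restrict (Metric.closedBall x₀ r)) +
  ((μH[(n - 1 : ℝ)]).restrict (Metric.sphere x₀ r)).prod
      (volume.restrict (Set.Ioo (t₀ - r ^ 2) t₀))

/-- Definition 4.2: `Ω` is parabolically accessible with constants `δ₀, c₀ > 0`, `N ∈ ℕ`. -/
structure ParAccessible (n : ℕ) (Ω : Set (EuclideanSpace ℝ (Fin n) × ℝ))
    (δ₀ c₀ : ℝ) (N : ℕ) : Prop where
  isOpen : IsOpen Ω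
  chain : ∀ δ ∈ Set.Ioo (0:ℝ) δ₀, ∀ p₀ ∈ pint Ω (δ/2) ∩ Q n (1 - δ),
    ∃ p : ℕ → EuclideanSpace ℝ (Fin n) × ℝ, p 0 = p₀ ∧
      (∀ i : ℕ, 1 ≤ i → i ≤ N → p i ∈ Ω) ∧
      p N ∈ pint Ω δ ∧
      ∀ i < N, (p (i+1)).2 ≤ (p i).2 ∧
        pcylinder n (2 * Real.sqrt ((p i).2 - (p (i+1)).2)) (p i).1 (p i).2 ⊆ Ω ∧
        ‖(p i).1 - (p (i+1)).1‖ ≤ Real.sqrt ((p i).2 - (p (i+1)).2)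
  density : ∀ δ ∈ Set.Ioo (0:ℝ) δ₀, ∀ p₀ ∈ Ω ∩ Q n (1 - 2*δ),
    ENNReal.ofReal c₀ * pbSurfaceMeasureCyl n (2*δ) p₀.1 p₀.2 Set.univ ≤
      pbSurfaceMeasureCyl n (2*δ) p₀.1 p₀.2 (pint Ω δ ∪ Ωᶜ)

/-- The `ℓ²`-norm of the coordinates `x_{m+1},…,x_n` (the `ȳ`-part) of `x ∈ ℝⁿ`. -/
def ybarNorm (n m : ℕ) (x : EuclideanSpace ℝ (Fin n)) : ℝ :=
  Real.sqrt (∑ i : Fin n, if m ≤ (i : ℕ) then x i ^ 2 else 0)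

/-- The `ℓ²`-norm of the coordinates `x_1,…,x_m` (the `x̄`-part) of `x ∈ ℝⁿ`. -/
def xbarNorm (n m : ℕ) (x : EuclideanSpace ℝ (Fin n)) : ℝ :=
  Real.sqrt (∑ i : Fin n, if (i : ℕ) < m then x i ^ 2 else 0)

/-- Definition 4.1: `D_{η,m} = {|ȳ| > η|t|^{1/2}} ∩ {|ȳ| > η|x̄|}`. -/
def Dset (n m : ℕ) (η : ℝ) : Set (EuclideanSpace ℝ (Fin n) × ℝ) :=
  {p | η * Real.sqrt |p.2| < ybarNorm n m p.1 ∧ η * xbarNorm n m p.1 < ybarNorm n m p.1}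

/-- The `ℓ²`-norm of the coordinates selected by `P` is 1-Lipschitz. -/
theorem sqrt_sum_ite_sq_le_add_norm_sub {n : ℕ} (P : Fin n → Prop) [DecidablePred P]
    (x y : EuclideanSpace ℝ (Fin n)) :
    Real.sqrt (∑ i, if P i then x i ^ 2 else 0) ≤
      Real.sqrt (∑ i, if P i then y i ^ 2 else 0) + ‖x - y‖ := by
  have key (z : EuclideanSpace ℝ (Fin n)) : Real.sqrt (∑ i, if P i then z i ^ 2 else 0) =
      ‖(WithLp.toLp 2 fun i => if P i then z i else 0 : EuclideanSpace ℝ (Fin n))‖ := by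
    rw [EuclideanSpace.norm_eq]
    congr 1
    refine Finset.sum_congr rfl fun i _ => ?_
    by_cases h : P i <;> simp [h]
  have hsub : ‖(WithLp.toLp 2 fun i => if P i then (x - y) i else 0 :
      EuclideanSpace ℝ (Fin n))‖ ≤ ‖x - y‖ := by
    rw [← key, EuclideanSpace.norm_eq]
    refine Real.sqrt_le_sqrt (Finset.sum_le_sum fun i _ => ?_)
    by_cases h : P i <;> simp [h, sq_nonneg]
  rw [key, key]
  refine le_trans ?_ (add_le_add_right hsub _)
  refine le_trans (le_of_eq ?_) (norm_add_le _ _)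
  congr 1
  ext i
  by_cases h : P i <;> simp [h]

theorem ybarNorm_le_add_norm_sub (n m : ℕ) (x y : EuclideanSpace ℝ (Fin n)) :
    ybarNorm n m x ≤ ybarNorm n m y + ‖x - y‖ :=
  sqrt_sum_ite_sq_le_add_norm_sub _ x y

theorem xbarNorm_le_add_norm_sub (n m : ℕ) (x y : EuclideanSpace ℝ (Fin n)) :
    xbarNorm n m x ≤ xbarNorm n m y + ‖x - y‖ :=
  sqrt_sum_ite_sq_le_add_norm_sub _ x y

theorem continuous_ybarNorm (n m : ℕ) : Continuous (ybarNorm n m) := by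
  refine Real.continuous_sqrt.comp (continuous_finsetSum _ fun i _ => ?_)
  split_ifs <;> fun_prop

theorem continuous_xbarNorm (n m : ℕ) : Continuous (xbarNorm n m) := by
  refine Real.continuous_sqrt.comp (continuous_finsetSum _ fun i _ => ?_)
  split_ifs <;> fun_prop

theorem isOpen_Dset (n m : ℕ) (η : ℝ) : IsOpen (Dset n m η) := by
  have hx := continuous_xbarNorm n m
  have hy := continuous_ybarNorm n m
  have ht : IsOpen {p : EuclideanSpace ℝ (Fin n) × ℝ |
      η * Real.sqrt |p.2| < ybarNorm n m p.1} := isOpen_lt (by fun_prop) (by fun_prop)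
  have hs : IsOpen {p : EuclideanSpace ℝ (Fin n) × ℝ |
      η * xbarNorm n m p.1 < ybarNorm n m p.1} := isOpen_lt (by fun_prop) (by fun_prop)
  exact ht.inter hs

/-- Multiply the `ȳ`-part of `x` by `c`, leaving the `x̄`-part unchanged. -/
def scaleYbar {n : ℕ} (m : ℕ) (x : EuclideanSpace ℝ (Fin n)) (c : ℝ) :
    EuclideanSpace ℝ (Fin n) :=
  WithLp.toLp 2 fun i => if m ≤ (i : ℕ) then c * x i else x i

theorem continuous_scaleYbar {n : ℕ} (m : ℕ) (x : EuclideanSpace ℝ (Fin n)) :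
    Continuous (scaleYbar m x) := by
  refine (PiLp.continuous_toLp 2 _).comp (continuous_pi fun i => ?_)
  split_ifs <;> fun_prop

theorem ybarNorm_scaleYbar {n : ℕ} (m : ℕ) (x : EuclideanSpace ℝ (Fin n)) {c : ℝ}
    (hc : 0 ≤ c) : ybarNorm n m (scaleYbar m x c) = c * ybarNorm n m x := by
  rw [ybarNorm, ybarNorm, ← Real.sqrt_sq hc, ← Real.sqrt_mul (sq_nonneg c), Real.sqrt_sq hc,
    Finset.mul_sum]
  congr 1
  refine Finset.sum_congr rfl fun i _ => ?_
  by_cases h : m ≤ (i : ℕ) <;> simp [scaleYbar, h, mul_pow]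

theorem xbarNorm_scaleYbar {n : ℕ} (m : ℕ) (x : EuclideanSpace ℝ (Fin n)) (c : ℝ) :
    xbarNorm n m (scaleYbar m x c) = xbarNorm n m x := by
  rw [xbarNorm, xbarNorm]
  congr 1
  refine Finset.sum_congr rfl fun i _ => ?_
  by_cases h : (i : ℕ) < m
  · simp [scaleYbar, h, not_le.mpr h]
  · simp [h]

theorem norm_sub_scaleYbar {n : ℕ} (m : ℕ) (x : EuclideanSpace ℝ (Fin n)) {c : ℝ}
    (hc : c ≤ 1) : ‖x - scaleYbar m x c‖ = (1 - c) * ybarNorm n m x := by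
  rw [← ybarNorm_scaleYbar m x (sub_nonneg.mpr hc), EuclideanSpace.norm_eq, ybarNorm]
  congr 1
  refine Finset.sum_congr rfl fun i _ => ?_
  by_cases h : m ≤ (i : ℕ)
  · simp [scaleYbar, h, sub_mul]
  · simp [scaleYbar, h]

/-- Shrinking the `ȳ`-part of a point of `D_{η,m}` reaches the boundary of `D_{η,m}` at a
parabolic distance equal to the smaller of the two gaps. -/
theorem exists_mem_frontier_Dset_pdist_eq {n m : ℕ} {η : ℝ} (hη : 0 ≤ η)
    {p : EuclideanSpace ℝ (Fin n) × ℝ} (hp : p ∈ Dset n m η) :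
    ∃ q ∈ frontier (Dset n m η), pdist p q =
      min (ybarNorm n m p.1 - η * Real.sqrt |p.2|)
        (ybarNorm n m p.1 - η * xbarNorm n m p.1) := by
  obtain ⟨h₁, h₂⟩ := hp
  set Y := ybarNorm n m p.1 with hY
  set M := max (η * Real.sqrt |p.2|) (η * xbarNorm n m p.1) with hM
  have hM0 : 0 ≤ M := le_max_of_le_left (by positivity)
  have hMY : M < Y := max_lt h₁ h₂
  have hY0 : 0 < Y := hM0.trans_lt hMY
  have hc0 : 0 ≤ M / Y := by positivity
  have hc1 : M / Y < 1 := (div_lt_one hY0).mpr hMY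
  have hcY : M / Y * Y = M := div_mul_cancel₀ M hY0.ne'
  refine ⟨(scaleYbar m p.1 (M / Y), p.2), ?_, ?_⟩
  · rw [(isOpen_Dset n m η).frontier_eq]
    refine ⟨?_, ?_⟩
    · have hcont : Continuous fun c : ℝ => (scaleYbar m p.1 c, p.2) :=
        (continuous_scaleYbar m p.1).prodMk continuous_const
      refine map_mem_closure (s := Set.Ioi (M / Y)) (x := M / Y)
        (f := fun c : ℝ => (scaleYbar m p.1 c, p.2)) hcont (by simp) fun c hc => ?_
      have hc' : M / Y < c := hc
      have hMc : M < c * Y := (div_lt_iff₀ hY0).mp hc'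
      simp only [Dset, Set.mem_ofPred_eq, ybarNorm_scaleYbar m p.1 (hc0.trans hc'.le),
        xbarNorm_scaleYbar, ← hY]
      exact ⟨(le_max_left _ _).trans_lt hMc, (le_max_right _ _).trans_lt hMc⟩
    · simp only [Dset, Set.mem_ofPred_eq, ybarNorm_scaleYbar m p.1 hc0,
        xbarNorm_scaleYbar, ← hY, hcY]
      rintro ⟨h₃, h₄⟩
      exact lt_irrefl M (max_lt h₃ h₄)
  · simp only [pdist, sub_self, abs_zero, add_zero]
    rw [Real.sqrt_sq (norm_nonneg _), norm_sub_scaleYbar m p.1 hc1.le, ← hY, sub_mul, hcY, one_mul,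
      hM, min_sub_sub_left]

theorem sqrt_abs_le_add_sqrt_abs_sub (s t : ℝ) :
    Real.sqrt |s| ≤ Real.sqrt |t| + Real.sqrt |t - s| := by
  refine Real.sqrt_le_iff.mpr ⟨by positivity, ?_⟩
  have htri : |s| ≤ |t| + |t - s| := by
    linarith [abs_sub_abs_le_abs_sub s t, abs_sub_comm s t]
  have hmul : 0 ≤ Real.sqrt |t| * Real.sqrt |t - s| := by positivity
  rw [add_sq, Real.sq_sqrt (abs_nonneg _), Real.sq_sqrt (abs_nonneg _)]
  linarith

theorem min_gap_le_mul_pdist {n m : ℕ} {η : ℝ} (hη : 0 ≤ η)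
    (p : EuclideanSpace ℝ (Fin n) × ℝ) {q : EuclideanSpace ℝ (Fin n) × ℝ}
    (hq : q ∉ Dset n m η) :
    min (ybarNorm n m p.1 - η * Real.sqrt |p.2|)
      (ybarNorm n m p.1 - η * xbarNorm n m p.1) ≤ (1 + η) * pdist p q := by
  have hnorm : ‖p.1 - q.1‖ ≤ pdist p q :=
    Real.le_sqrt_of_sq_le (le_add_of_nonneg_right (abs_nonneg _))
  have htime : Real.sqrt |p.2 - q.2| ≤ pdist p q :=
    Real.sqrt_le_sqrt (le_add_of_nonneg_left (sq_nonneg _))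
  have hy := ybarNorm_le_add_norm_sub n m p.1 q.1
  by_cases h : η * Real.sqrt |q.2| < ybarNorm n m q.1
  · have h' : ybarNorm n m q.1 ≤ η * xbarNorm n m q.1 := not_lt.mp fun h' => hq ⟨h, h'⟩
    have hx := xbarNorm_le_add_norm_sub n m q.1 p.1
    rw [norm_sub_rev] at hx
    have := mul_le_mul_of_nonneg_left (hx.trans (add_le_add_right hnorm _)) hη
    exact (min_le_right _ _).trans (by linarith)
  · have := mul_le_mul_of_nonneg_left
      ((sqrt_abs_le_add_sqrt_abs_sub q.2 p.2).trans (add_le_add_right htime _)) hη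
    exact (min_le_left _ _).trans (by linarith)

/-- **Lemma 4.6, Step 1 (geometric observation).** For every `p = (x̄₀,ȳ₀,t₀) ∈ D_{η,m}`,
`d_p(p, ∂D_{η,m}) ≤ min{|ȳ₀| - η|t₀|^{1/2}, |ȳ₀| - η|x̄₀|} ≤ (1+η) d_p(p, ∂D_{η,m})`. -/
theorem pdist_to_Dset_frontier
    (n m : ℕ) (hn : 2 ≤ n) (hm : m ≤ n - 2) (η : ℝ) (hη : η ∈ Set.Ioo (0:ℝ) (1/4))
    (p : EuclideanSpace ℝ (Fin n) × ℝ) (hp : p ∈ Dset n m η) :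
    sInf {d : ℝ | ∃ q ∈ frontier (Dset n m η), d = pdist p q} ≤
        min (ybarNorm n m p.1 - η * Real.sqrt |p.2|)
          (ybarNorm n m p.1 - η * xbarNorm n m p.1) ∧
      min (ybarNorm n m p.1 - η * Real.sqrt |p.2|)
          (ybarNorm n m p.1 - η * xbarNorm n m p.1) ≤
        (1 + η) * sInf {d : ℝ | ∃ q ∈ frontier (Dset n m η), d = pdist p q} := by
  obtain ⟨q, hq, hpq⟩ := exists_mem_frontier_Dset_pdist_eq hη.1.le hp
  have hη' : 0 < 1 + η := by linarith [hη.1]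
  refine ⟨csInf_le ⟨0, ?_⟩ ⟨q, hq, hpq.symm⟩, ?_⟩
  · rintro _ ⟨_, _, rfl⟩
    exact Real.sqrt_nonneg _
  · rw [← div_le_iff₀' hη']
    refine le_csInf ⟨_, q, hq, rfl⟩ ?_
    rintro _ ⟨q', hq', rfl⟩
    rw [(isOpen_Dset n m η).frontier_eq] at hq'
    exact (div_le_iff₀' hη').mpr (min_gap_le_mul_pdist hη.1.le p hq'.2)

end
end

section
/- Let η ∈ (0,1/4) and m ∈ {0,…,n−2}, and set K_η := {x ∈ ℝ^n : |ȳ| ≤ η·max{1,|x|}}, where x = (x̄,ȳ) ∈ ℝ^m × ℝ^{n−m}. Then the Gaussian Rayleigh quotient infimum inf { ∫_{ℝ^n} |∇v|^2 e^{−|x|^2/4} dx / ∫_{ℝ^n} v^2 e^{−|x|^2/4} dx : v Lipschitz, compactly supported in ℝ^n ∖ K_η, v ≢ 0 } satisfies: it is at most C |log η|^{−1} if m = n−2, and at most C η^{n−m−2} if m < n−2, where C depends only on n and m. -/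
open Metric Set MeasureTheory Filter

noncomputable section

/-- The cone `K_η = {x : |ȳ| ≤ η max{1,|x|}}`. -/
def Kcone (n m : ℕ) (η : ℝ) : Set (EuclideanSpace ℝ (Fin n)) :=
  {x | ybarNorm n m x ≤ η * max 1 ‖x‖}

/-- The set of Gaussian Rayleigh quotients of nonzero compactly supported Lipschitz
functions vanishing on the cone `K_η`; its infimum is the first Dirichlet eigenvalue of the
Ornstein–Uhlenbeck operator on `ℝⁿ ∖ K_η`. -/
def rayleighSet (n m : ℕ) (η : ℝ) : Set ℝ :=
  {ρ | ∃ v : EuclideanSpace ℝ (Fin n) → ℝ,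
    (∃ K : NNReal, LipschitzWith K v) ∧ HasCompactSupport v ∧
    tsupport v ⊆ (Kcone n m η)ᶜ ∧ v ≠ 0 ∧
    ρ = (∫ x, ‖fderiv ℝ v x‖ ^ 2 * Real.exp (-‖x‖ ^ 2 / 4)) /
        (∫ x, (v x) ^ 2 * Real.exp (-‖x‖ ^ 2 / 4))}

/-- The truncation of a real number to the unit interval. -/
def ramp (t : ℝ) : ℝ := max 0 (min 1 t)

lemma ramp_nonneg (t : ℝ) : 0 ≤ ramp t := le_max_left _ _

lemma ramp_le_one (t : ℝ) : ramp t ≤ 1 := max_le zero_le_one (min_le_left _ _)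

lemma ramp_of_nonpos {t : ℝ} (ht : t ≤ 0) : ramp t = 0 :=
  max_eq_left ((min_le_right _ _).trans ht)

lemma ramp_of_one_le {t : ℝ} (ht : 1 ≤ t) : ramp t = 1 := by
  simp [ramp, min_eq_left ht]

lemma abs_ramp_sub_le (s t : ℝ) : |ramp s - ramp t| ≤ |s - t| := by
  unfold ramp
  rw [max_comm 0, max_comm 0, min_comm 1, min_comm 1]
  refine (abs_max_sub_max_le_abs _ _ _).trans ?_
  simpa using abs_min_sub_min_le_max s 1 t 1

/-- The average of `N` ramps, the `j`-th of which rises from `0` to `1` on `[2^j δ, 2^(j+1) δ]`. -/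
def dyadicCutoff (N : ℕ) (δ t : ℝ) : ℝ :=
  (N : ℝ)⁻¹ * ∑ j ∈ Finset.range N, ramp (t / (2 ^ j * δ) - 1)

lemma dyadicCutoff_nonneg (N : ℕ) (δ t : ℝ) : 0 ≤ dyadicCutoff N δ t :=
  mul_nonneg (by positivity) (Finset.sum_nonneg fun _ _ => ramp_nonneg _)

lemma dyadicCutoff_le_one (N : ℕ) (δ t : ℝ) : dyadicCutoff N δ t ≤ 1 := by
  have h : ∑ j ∈ Finset.range N, ramp (t / (2 ^ j * δ) - 1) ≤ ∑ j ∈ Finset.range N, (1 : ℝ) :=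
    Finset.sum_le_sum fun _ _ => ramp_le_one _
  rw [Finset.sum_const, Finset.card_range, nsmul_one] at h
  rw [dyadicCutoff, inv_mul_eq_div]
  exact div_le_one_of_le₀ h (Nat.cast_nonneg _)

lemma dyadicCutoff_of_le {N : ℕ} {δ t : ℝ} (hδ : 0 < δ) (ht : t ≤ δ) :
    dyadicCutoff N δ t = 0 := by
  rw [dyadicCutoff, Finset.sum_eq_zero, mul_zero]
  intro j _
  refine ramp_of_nonpos (sub_nonpos.2 ((div_le_one (by positivity)).2 (ht.trans ?_)))
  exact le_mul_of_one_le_left hδ.le (one_le_pow₀ one_le_two)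

lemma dyadicCutoff_of_ge {N : ℕ} (hN : N ≠ 0) {δ t : ℝ} (hδ : 0 < δ) (ht : 2 ^ N * δ ≤ t) :
    dyadicCutoff N δ t = 1 := by
  rw [dyadicCutoff, Finset.sum_congr rfl (g := fun _ => (1 : ℝ))]
  · simp [hN]
  intro j hj
  refine ramp_of_one_le ?_
  have h : (2 : ℝ) ^ (j + 1) ≤ 2 ^ N :=
    pow_le_pow_right₀ one_le_two (Finset.mem_range.1 hj)
  rw [le_sub_iff_add_le, le_div_iff₀ (by positivity)]
  rw [pow_succ] at h
  nlinarith

lemma abs_ramp_scale_sub_le {d : ℝ} (hd : 0 < d) (s t : ℝ) :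
    |ramp (s / d - 1) - ramp (t / d - 1)| ≤ d⁻¹ * |s - t| := by
  refine (abs_ramp_sub_le _ _).trans (le_of_eq ?_)
  rw [sub_sub_sub_cancel_right, ← sub_div, abs_div, abs_of_pos hd, div_eq_inv_mul]

lemma abs_dyadicCutoff_sub_le (N : ℕ) {δ : ℝ} (hδ : 0 < δ) (s t : ℝ) :
    |dyadicCutoff N δ s - dyadicCutoff N δ t| ≤
      (N : ℝ)⁻¹ * (∑ j ∈ Finset.range N, (2 ^ j * δ)⁻¹) * |s - t| := by
  rw [dyadicCutoff, dyadicCutoff, ← mul_sub, ← Finset.sum_sub_distrib, abs_mul, mul_assoc,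
    abs_of_nonneg (by positivity : (0 : ℝ) ≤ (N : ℝ)⁻¹), Finset.sum_mul]
  gcongr
  exact (Finset.abs_sum_le_sum_abs _ _).trans
    (Finset.sum_le_sum fun j _ => abs_ramp_scale_sub_le (by positivity) s t)

/-- The scales `2^j δ` at which the dyadic cutoff varies near `t`. -/
def activeScales (N : ℕ) (δ t : ℝ) : Finset ℕ :=
  {j ∈ Finset.range N | 2 ^ j * δ ≤ t ∧ t ≤ 2 * (2 ^ j * δ)}

lemma eventually_abs_dyadicCutoff_sub_le (N : ℕ) {δ : ℝ} (hδ : 0 < δ) (t : ℝ) :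
    ∀ᶠ s in nhds t, |dyadicCutoff N δ s - dyadicCutoff N δ t| ≤
      (N : ℝ)⁻¹ * (∑ j ∈ activeScales N δ t, (2 ^ j * δ)⁻¹) * |s - t| := by
  have key : ∀ j ∈ Finset.range N, ∀ᶠ s in nhds t,
      |ramp (s / (2 ^ j * δ) - 1) - ramp (t / (2 ^ j * δ) - 1)| ≤
        if 2 ^ j * δ ≤ t ∧ t ≤ 2 * (2 ^ j * δ) then (2 ^ j * δ)⁻¹ * |s - t| else 0 := by
    intro j _
    have hd : 0 < 2 ^ j * δ := by positivity
    generalize 2 ^ j * δ = d at hd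
    split_ifs with h
    · exact Eventually.of_forall fun s => abs_ramp_scale_sub_le hd s t
    · have zero_of_le : ∀ s ≤ d, ramp (s / d - 1) = 0 := fun s hs =>
        ramp_of_nonpos (sub_nonpos.2 ((div_le_one hd).2 hs))
      have one_of_ge : ∀ s, 2 * d ≤ s → ramp (s / d - 1) = 1 := fun s hs =>
        ramp_of_one_le (by rw [le_sub_iff_add_le, le_div_iff₀ hd]; linarith)
      rcases lt_or_ge t d with hlt | hge
      · filter_upwards [Iio_mem_nhds hlt] with s hs
        simp [zero_of_le s (le_of_lt hs), zero_of_le t hlt.le]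
      · have hgt : 2 * d < t := not_le.1 fun h' => h ⟨hge, h'⟩
        filter_upwards [Ioi_mem_nhds hgt] with s hs
        simp [one_of_ge s (le_of_lt hs), one_of_ge t hgt.le]
  filter_upwards [(Finset.eventually_all _).2 key] with s hs
  rw [dyadicCutoff, dyadicCutoff, ← mul_sub, ← Finset.sum_sub_distrib, abs_mul, mul_assoc,
    abs_of_nonneg (by positivity : (0 : ℝ) ≤ (N : ℝ)⁻¹), Finset.sum_mul, activeScales,
    Finset.sum_filter]
  gcongr
  exact (Finset.abs_sum_le_sum_abs _ _).trans (Finset.sum_le_sum hs)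

lemma card_activeScales_le (N : ℕ) {δ : ℝ} (hδ : 0 < δ) (t : ℝ) :
    (activeScales N δ t).card ≤ 2 := by
  rcases lt_or_ge t δ with hlt | hge
  · rw [activeScales, Finset.filter_false_of_mem]
    · simp
    · rintro j - ⟨h, -⟩
      have : δ ≤ 2 ^ j * δ := le_mul_of_one_le_left hδ.le (one_le_pow₀ one_le_two)
      linarith
  · obtain ⟨i, hi, hi'⟩ := exists_nat_pow_near ((one_le_div hδ).2 hge) (one_lt_two (α := ℝ))
    rw [le_div_iff₀ hδ] at hi
    rw [div_lt_iff₀ hδ] at hi'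
    have hsub : activeScales N δ t ⊆ Finset.Icc (i - 1) i := by
      intro j hj
      obtain ⟨-, h1, h2⟩ := Finset.mem_filter.1 hj
      have h3 : (2 : ℝ) ^ j < 2 ^ (i + 1) := lt_of_mul_lt_mul_right (h1.trans_lt hi') hδ.le
      have h4 : (2 : ℝ) ^ i ≤ 2 ^ (j + 1) := by
        refine le_of_mul_le_mul_right (hi.trans (h2.trans_eq ?_)) hδ
        ring
      have h5 := (pow_lt_pow_iff_right₀ (one_lt_two (α := ℝ))).1 h3
      have h6 := (pow_le_pow_iff_right₀ (one_lt_two (α := ℝ))).1 h4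
      rw [Finset.mem_Icc]
      omega
    refine (Finset.card_le_card hsub).trans ?_
    rw [Nat.card_Icc]
    omega

lemma sq_sum_activeScales_le (N : ℕ) {δ : ℝ} (hδ : 0 < δ) (t : ℝ) :
    (∑ j ∈ activeScales N δ t, (2 ^ j * δ)⁻¹) ^ 2 ≤
      2 * ∑ j ∈ activeScales N δ t, ((2 ^ j * δ)⁻¹) ^ 2 := by
  refine sq_sum_le_card_mul_sum_sq.trans ?_
  gcongr
  exact_mod_cast card_activeScales_le N hδ t

section

variable {n : ℕ}

lemma ybarNorm_nonneg (m : ℕ) (x : EuclideanSpace ℝ (Fin n)) : 0 ≤ ybarNorm n m x :=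
  Real.sqrt_nonneg _

lemma ybarNorm_le_norm (m : ℕ) (x : EuclideanSpace ℝ (Fin n)) : ybarNorm n m x ≤ ‖x‖ := by
  rw [EuclideanSpace.norm_eq, ybarNorm]
  refine Real.sqrt_le_sqrt (Finset.sum_le_sum fun i _ => ?_)
  split_ifs
  · simp
  · positivity

lemma abs_apply_le_ybarNorm {m : ℕ} (x : EuclideanSpace ℝ (Fin n)) {i : Fin n} (hi : m ≤ i) :
    |x i| ≤ ybarNorm n m x := by
  refine Real.abs_le_sqrt ?_
  have h := Finset.single_le_sum (f := fun i : Fin n => if m ≤ (i : ℕ) then x i ^ 2 else 0)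
    (fun j _ => by dsimp only; split_ifs <;> positivity) (Finset.mem_univ i)
  simpa [hi] using h

lemma abs_ybarNorm_sub_le (m : ℕ) (x y : EuclideanSpace ℝ (Fin n)) :
    |ybarNorm n m x - ybarNorm n m y| ≤ ‖x - y‖ := by
  have eq_norm : ∀ z : EuclideanSpace ℝ (Fin n), ybarNorm n m z =
      ‖(WithLp.toLp 2 fun i : Fin n => if m ≤ (i : ℕ) then z i else 0 :
        EuclideanSpace ℝ (Fin n))‖ := by
    intro z
    rw [EuclideanSpace.norm_eq, ybarNorm]
    congr 1
    refine Finset.sum_congr rfl fun i _ => ?_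
    by_cases h : m ≤ (i : ℕ) <;> simp [h]
  refine le_trans ?_ (ybarNorm_le_norm m (x - y))
  rw [eq_norm x, eq_norm y, eq_norm (x - y)]
  refine (abs_norm_sub_norm_le _ _).trans (le_of_eq ?_)
  congr 1
  ext i
  by_cases h : m ≤ (i : ℕ) <;> simp [h]

/-- The ratio `|ȳ| / max{1,|x|}`, whose sublevel sets are the cones `K_η`. -/
def coneRatio (m : ℕ) (x : EuclideanSpace ℝ (Fin n)) : ℝ :=
  ybarNorm n m x / max 1 ‖x‖

lemma mem_Kcone_iff {m : ℕ} {η : ℝ} {x : EuclideanSpace ℝ (Fin n)} :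
    x ∈ Kcone n m η ↔ coneRatio m x ≤ η := by
  rw [coneRatio, div_le_iff₀ (lt_max_of_lt_left one_pos)]
  rfl

lemma coneRatio_le_one (m : ℕ) (x : EuclideanSpace ℝ (Fin n)) : coneRatio m x ≤ 1 :=
  div_le_one_of_le₀ ((ybarNorm_le_norm m x).trans (le_max_right _ _))
    (zero_le_one.trans (le_max_left _ _))

lemma abs_coneRatio_sub_le (m : ℕ) (x y : EuclideanSpace ℝ (Fin n)) :
    |coneRatio m x - coneRatio m y| ≤ 2 * ‖x - y‖ := by
  have hy := coneRatio_le_one m y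
  have hy0 : 0 ≤ coneRatio m y := div_nonneg (ybarNorm_nonneg m y) (by positivity)
  have hM : |max 1 ‖x‖ - max 1 ‖y‖| ≤ ‖x - y‖ := by
    rw [max_comm 1, max_comm 1]
    exact (abs_max_sub_max_le_abs _ _ _).trans (abs_norm_sub_norm_le x y)
  have hY := abs_ybarNorm_sub_le m x y
  have hx1 : 1 ≤ max 1 ‖x‖ := le_max_left _ _
  have hy1 : 1 ≤ max 1 ‖y‖ := le_max_left _ _
  have hdecomp : coneRatio m x - coneRatio m y =
      ((ybarNorm n m x - ybarNorm n m y) - coneRatio m y * (max 1 ‖x‖ - max 1 ‖y‖))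
        / max 1 ‖x‖ := by
    rw [coneRatio, coneRatio]
    field_simp
    ring
  rw [hdecomp, abs_div, abs_of_pos (zero_lt_one.trans_le hx1)]
  refine (div_le_self (abs_nonneg _) hx1).trans ((abs_sub _ _).trans ?_)
  rw [abs_mul, abs_of_nonneg hy0]
  nlinarith [abs_nonneg (max 1 ‖x‖ - max 1 ‖y‖)]

lemma continuous_coneRatio (m : ℕ) :
    Continuous (coneRatio m : EuclideanSpace ℝ (Fin n) → ℝ) :=
  (LipschitzWith.of_dist_le_mul (K := 2) fun x y => by
    rw [Real.dist_eq, dist_eq_norm]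
    exact abs_coneRatio_sub_le m x y).continuous

/-- A product of Cauchy densities, at scale `s` in the `ȳ`-coordinates and at scale `1` in the
others. -/
def cauchyKernel (m : ℕ) (s : ℝ) (x : EuclideanSpace ℝ (Fin n)) : ℝ :=
  ∏ i : Fin n, (1 + (x i / if m ≤ (i : ℕ) then s else 1) ^ 2)⁻¹

lemma cauchyKernel_nonneg (m : ℕ) (s : ℝ) (x : EuclideanSpace ℝ (Fin n)) :
    0 ≤ cauchyKernel m s x :=
  Finset.prod_nonneg fun _ _ => by positivity

lemma integrable_cauchyKernel (m : ℕ) {s : ℝ} (hs : 0 < s) :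
    Integrable (cauchyKernel m s : EuclideanSpace ℝ (Fin n) → ℝ) := by
  have h : Integrable fun x : Fin n → ℝ =>
      ∏ i : Fin n, (1 + (x i / if m ≤ (i : ℕ) then s else 1) ^ 2)⁻¹ :=
    Integrable.fintype_prod (f := fun (i : Fin n) (t : ℝ) =>
      (1 + (t / if m ≤ (i : ℕ) then s else 1) ^ 2)⁻¹) fun i =>
        integrable_inv_one_add_sq.comp_div (by split_ifs <;> positivity)
  exact (PiLp.volume_preserving_ofLp (Fin n)).integrable_comp_of_integrable h

lemma integral_cauchyKernel (m : ℕ) {s : ℝ} (hs : 0 < s) :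
    ∫ x : EuclideanSpace ℝ (Fin n), cauchyKernel m s x = Real.pi ^ n * s ^ (n - m) := by
  have h := (PiLp.volume_preserving_ofLp (Fin n)).integral_comp
    (MeasurableEquiv.toLp 2 (Fin n → ℝ)).symm.measurableEmbedding
    (fun x : Fin n → ℝ => ∏ i : Fin n, (1 + (x i / if m ≤ (i : ℕ) then s else 1) ^ 2)⁻¹)
  refine h.trans ?_
  rw [integral_fintype_prod_volume_eq_prod (fun (i : Fin n) (t : ℝ) =>
      (1 + (t / if m ≤ (i : ℕ) then s else 1) ^ 2)⁻¹)]
  have h1 : ∀ i : Fin n, ∫ t : ℝ, (1 + (t / if m ≤ (i : ℕ) then s else 1) ^ 2)⁻¹ =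
      (if m ≤ (i : ℕ) then s else 1) * Real.pi := by
    intro i
    rw [Measure.integral_comp_div (fun t : ℝ => (1 + t ^ 2)⁻¹), integral_univ_inv_one_add_sq,
      smul_eq_mul, abs_of_nonneg]
    split_ifs <;> positivity
  rw [Finset.prod_congr rfl fun i _ => h1 i, Finset.prod_mul_distrib, Finset.prod_const,
    Finset.card_fin, mul_comm, Finset.prod_ite, Finset.prod_const, Finset.prod_const_one, mul_one]
  congr 2
  have hcard := Finset.card_filter_add_card_filter_not (s := Finset.univ)
    (fun i : Fin n => (i : ℕ) < m)
  rw [Fin.card_filter_val_lt, Finset.card_fin] at hcard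
  simp only [not_lt] at hcard
  omega

/-- The constant in the comparison of the Gaussian weight with `cauchyKernel`. -/
def gaussConst (n : ℕ) : ℝ := 8 ^ n * n.factorial * Real.exp (1 / 4)

lemma gaussConst_pos (n : ℕ) : 0 < gaussConst n := by
  unfold gaussConst; positivity

/-- On the cone of aperture `s` the Gaussian weight is dominated by a product kernel concentrated
at scale `s` in the `ȳ`-directions. -/
lemma exp_le_cauchyKernel {m : ℕ} {s : ℝ} (hs : 0 < s) {x : EuclideanSpace ℝ (Fin n)}
    (hx : coneRatio m x ≤ s) :
    Real.exp (-‖x‖ ^ 2 / 4) ≤ gaussConst n * cauchyKernel m s x := by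
  set z : ℝ := 1 + ‖x‖ ^ 2 with hz
  have hz0 : 0 < z := by positivity
  have hM : max 1 ‖x‖ ^ 2 ≤ z := by
    rcases max_choice 1 ‖x‖ with h | h <;> rw [h, hz] <;> nlinarith [sq_nonneg ‖x‖]
  have hfac : ∀ i : Fin n, (2 * z)⁻¹ ≤ (1 + (x i / if m ≤ (i : ℕ) then s else 1) ^ 2)⁻¹ := by
    intro i
    refine inv_anti₀ (by positivity) ?_
    have h : (x i / if m ≤ (i : ℕ) then s else 1) ^ 2 ≤ z := by
      split_ifs with hi
      · refine le_trans ?_ hM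
        have h1 := (abs_apply_le_ybarNorm x hi).trans (mem_Kcone_iff.2 hx)
        rw [← sq_abs, abs_div, abs_of_pos hs]
        gcongr
        rwa [div_le_iff₀' hs]
      · have h1 := PiLp.norm_apply_le x i
        rw [div_one, ← sq_abs, hz]
        rw [Real.norm_eq_abs] at h1
        have := pow_le_pow_left₀ (abs_nonneg _) h1 2
        linarith
    have : 1 ≤ z := by rw [hz]; nlinarith [sq_nonneg ‖x‖]
    linarith
  have hprod : ((2 * z)⁻¹) ^ n ≤ cauchyKernel m s x := by
    have := Finset.prod_le_prod (s := Finset.univ) (fun (i : Fin n) _ => by positivity)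
      fun i _ => hfac i
    simpa [cauchyKernel] using this
  have hexp : (z / 4) ^ n / n.factorial ≤ Real.exp (z / 4) :=
    Real.pow_div_factorial_le_exp _ (by positivity) n
  refine le_trans ?_ (mul_le_mul_of_nonneg_left hprod (gaussConst_pos n).le)
  have hsplit : Real.exp (-‖x‖ ^ 2 / 4) = Real.exp (1 / 4) * (Real.exp (z / 4))⁻¹ := by
    rw [← Real.exp_neg, ← Real.exp_add, hz]
    congr 1
    ring
  rw [hsplit, gaussConst]
  have hinv : (Real.exp (z / 4))⁻¹ ≤ ((z / 4) ^ n / n.factorial)⁻¹ :=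
    inv_anti₀ (by positivity) hexp
  refine (mul_le_mul_of_nonneg_left hinv (Real.exp_pos _).le).trans (le_of_eq ?_)
  rw [show (8 : ℝ) = 2 * 4 by norm_num, mul_pow, inv_pow, mul_pow, div_pow]
  field_simp

/-- The test function: a dyadic cutoff of the cone ratio times a cutoff at radius `R`. -/
def testFunction (m N : ℕ) (δ R : ℝ) (x : EuclideanSpace ℝ (Fin n)) : ℝ :=
  dyadicCutoff N δ (coneRatio m x) * ramp (2 - ‖x‖ / R)

lemma abs_mul_sub_mul_le {a a' b b' : ℝ} (ha' : |a'| ≤ 1) (hb : |b| ≤ 1) :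
    |a * b - a' * b'| ≤ |a - a'| + |b - b'| := by
  have h : a * b - a' * b' = (a - a') * b + a' * (b - b') := by ring
  rw [h]
  refine (abs_add_le _ _).trans ?_
  rw [abs_mul, abs_mul]
  exact add_le_add (mul_le_of_le_one_right (abs_nonneg _) hb)
    (mul_le_of_le_one_left (abs_nonneg _) ha')

lemma abs_testFunction_sub_le (m N : ℕ) (δ : ℝ) {R : ℝ} (hR : 0 < R)
    (x y : EuclideanSpace ℝ (Fin n)) :
    |testFunction m N δ R x - testFunction m N δ R y| ≤
      |dyadicCutoff N δ (coneRatio m x) - dyadicCutoff N δ (coneRatio m y)| +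
        R⁻¹ * ‖x - y‖ := by
  refine (abs_mul_sub_mul_le ?_ ?_).trans ?_
  · rw [abs_of_nonneg (dyadicCutoff_nonneg _ _ _)]
    exact dyadicCutoff_le_one _ _ _
  · rw [abs_of_nonneg (ramp_nonneg _)]
    exact ramp_le_one _
  · gcongr
    refine (abs_ramp_sub_le _ _).trans ?_
    rw [sub_sub_sub_cancel_left, ← sub_div, abs_div, abs_of_pos hR, div_eq_inv_mul, abs_sub_comm]
    gcongr
    exact abs_norm_sub_norm_le x y

lemma exists_lipschitzWith_testFunction (m N : ℕ) {δ R : ℝ} (hδ : 0 < δ) (hR : 0 < R) :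
    ∃ K : NNReal, LipschitzWith K
      (testFunction m N δ R : EuclideanSpace ℝ (Fin n) → ℝ) := by
  refine ⟨⟨(N : ℝ)⁻¹ * (∑ j ∈ Finset.range N, (2 ^ j * δ)⁻¹) * 2 + R⁻¹, by positivity⟩,
    LipschitzWith.of_dist_le_mul fun x y => ?_⟩
  rw [Real.dist_eq, dist_eq_norm]
  refine (abs_testFunction_sub_le m N δ hR x y).trans ?_
  change _ ≤ ((N : ℝ)⁻¹ * (∑ j ∈ Finset.range N, (2 ^ j * δ)⁻¹) * 2 + R⁻¹) * ‖x - y‖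
  rw [add_mul, mul_assoc _ (2 : ℝ)]
  gcongr
  refine (abs_dyadicCutoff_sub_le N hδ _ _).trans ?_
  gcongr
  exact abs_coneRatio_sub_le m x y

lemma norm_fderiv_testFunction_le (m N : ℕ) {δ R : ℝ} (hδ : 0 < δ) (hR : 0 < R)
    (x : EuclideanSpace ℝ (Fin n)) :
    ‖fderiv ℝ (testFunction m N δ R) x‖ ≤
      (N : ℝ)⁻¹ * (∑ j ∈ activeScales N δ (coneRatio m x), (2 ^ j * δ)⁻¹) * 2 + R⁻¹ := by
  refine norm_fderiv_le_of_lip' ℝ (by positivity) ?_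
  filter_upwards [(continuous_coneRatio m).continuousAt.eventually
    (eventually_abs_dyadicCutoff_sub_le N hδ (coneRatio m x))] with y hy
  rw [Real.norm_eq_abs]
  refine (abs_testFunction_sub_le m N δ hR y x).trans ?_
  rw [add_mul, mul_assoc _ (2 : ℝ)]
  gcongr
  refine hy.trans ?_
  gcongr
  exact abs_coneRatio_sub_le m y x

lemma energy_density_le (m N : ℕ) {δ R : ℝ} (hδ : 0 < δ) (hR : 0 < R)
    (x : EuclideanSpace ℝ (Fin n)) :
    ‖fderiv ℝ (testFunction m N δ R) x‖ ^ 2 * Real.exp (-‖x‖ ^ 2 / 4) ≤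
      2 * (R⁻¹) ^ 2 * gaussConst n * cauchyKernel m 1 x +
        ∑ j ∈ Finset.range N, 16 * ((N : ℝ)⁻¹) ^ 2 * ((2 ^ j * δ)⁻¹) ^ 2 * gaussConst n *
          cauchyKernel m (2 * (2 ^ j * δ)) x := by
  set A := activeScales N δ (coneRatio m x) with hA
  set S := ∑ j ∈ A, (2 ^ j * δ)⁻¹ with hS
  have hsq : ‖fderiv ℝ (testFunction m N δ R) x‖ ^ 2 ≤
      2 * (R⁻¹) ^ 2 + 16 * ((N : ℝ)⁻¹) ^ 2 * ∑ j ∈ A, ((2 ^ j * δ)⁻¹) ^ 2 := by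
    have h1 := pow_le_pow_left₀ (norm_nonneg _) (norm_fderiv_testFunction_le m N hδ hR x) 2
    have h2 := sq_sum_activeScales_le N hδ (coneRatio m x)
    rw [← hA, ← hS] at h1 h2
    have h3 := mul_le_mul_of_nonneg_left h2 (by positivity : 0 ≤ 8 * ((N : ℝ)⁻¹) ^ 2)
    nlinarith [sq_nonneg ((N : ℝ)⁻¹ * S * 2 - R⁻¹)]
  refine (mul_le_mul_of_nonneg_right hsq (Real.exp_pos _).le).trans ?_
  rw [add_mul, mul_assoc (2 * (R⁻¹) ^ 2)]
  refine add_le_add ?_ ?_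
  · exact mul_le_mul_of_nonneg_left
      (exp_le_cauchyKernel one_pos (coneRatio_le_one m x)) (by positivity)
  · rw [Finset.mul_sum, Finset.sum_mul, hA, activeScales]
    refine (Finset.sum_le_sum fun j hj => ?_).trans
      (Finset.sum_le_sum_of_subset_of_nonneg (Finset.filter_subset _ _) fun j _ _ => ?_)
    · rw [mul_assoc _ (gaussConst n)]
      exact mul_le_mul_of_nonneg_left (exp_le_cauchyKernel (by positivity)
        (Finset.mem_filter.1 hj).2.2) (by positivity)
    · have := (gaussConst_pos n).le
      have := cauchyKernel_nonneg m (2 * (2 ^ j * δ)) x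
      positivity

lemma energy_le {m : ℕ} (hm : m + 2 ≤ n) (N : ℕ) {δ R : ℝ} (hδ : 0 < δ) (hR : 0 < R) :
    ∫ x : EuclideanSpace ℝ (Fin n),
        ‖fderiv ℝ (testFunction m N δ R) x‖ ^ 2 * Real.exp (-‖x‖ ^ 2 / 4) ≤
      16 * 2 ^ n * gaussConst n * Real.pi ^ n *
        ((R⁻¹) ^ 2 + ((N : ℝ)⁻¹) ^ 2 * ∑ j ∈ Finset.range N, (2 ^ j * δ) ^ (n - m - 2)) := by
  have hG := gaussConst_pos n
  have hkernel_unit := (integrable_cauchyKernel (n := n) m one_pos).const_mul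
    (2 * (R⁻¹) ^ 2 * gaussConst n)
  have hkernel_dyadic : ∀ j ∈ Finset.range N, Integrable fun x : EuclideanSpace ℝ (Fin n) =>
      16 * ((N : ℝ)⁻¹) ^ 2 * ((2 ^ j * δ)⁻¹) ^ 2 * gaussConst n *
        cauchyKernel m (2 * (2 ^ j * δ)) x := fun j _ =>
    (integrable_cauchyKernel (n := n) m (by positivity)).const_mul _
  refine (integral_mono_of_nonneg (Eventually.of_forall fun x => by positivity)
    (hkernel_unit.add (integrable_finsetSum _ hkernel_dyadic))
    (Eventually.of_forall fun x => energy_density_le m N hδ hR x)).trans ?_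
  simp only [Pi.add_apply]
  rw [integral_add hkernel_unit (integrable_finsetSum _ hkernel_dyadic), integral_finsetSum _ hkernel_dyadic,
    integral_const_mul, integral_cauchyKernel m one_pos, mul_add, one_pow, mul_one,
    Finset.mul_sum, Finset.mul_sum]
  refine add_le_add ?_ (Finset.sum_le_sum fun j _ => ?_)
  · have h2 : (1 : ℝ) ≤ 2 ^ n := one_le_pow₀ one_le_two
    have h3 : 0 ≤ (R⁻¹) ^ 2 * gaussConst n * Real.pi ^ n := by positivity
    nlinarith
  · rw [integral_const_mul, integral_cauchyKernel m (by positivity)]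
    have hd : 0 < 2 ^ j * δ := by positivity
    generalize 2 ^ j * δ = d at hd
    have hpow : (d⁻¹) ^ 2 * (2 * d) ^ (n - m) = 2 ^ (n - m) * d ^ (n - m - 2) := by
      obtain ⟨k, hk⟩ : ∃ k, n - m = k + 2 := ⟨n - m - 2, by omega⟩
      rw [hk, Nat.add_sub_cancel, mul_pow, pow_add d]
      field_simp
    have h2 : (2 : ℝ) ^ (n - m) ≤ 2 ^ n := pow_le_pow_right₀ one_le_two (Nat.sub_le _ _)
    calc 16 * ((N : ℝ)⁻¹) ^ 2 * (d⁻¹) ^ 2 * gaussConst n * (Real.pi ^ n * (2 * d) ^ (n - m))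
        = 16 * gaussConst n * Real.pi ^ n * ((N : ℝ)⁻¹) ^ 2 * d ^ (n - m - 2) *
            2 ^ (n - m) := by
          linear_combination (16 * ((N : ℝ)⁻¹) ^ 2 * gaussConst n * Real.pi ^ n) * hpow
      _ ≤ 16 * gaussConst n * Real.pi ^ n * ((N : ℝ)⁻¹) ^ 2 * d ^ (n - m - 2) * 2 ^ n := by
          gcongr
      _ = _ := by ring

lemma hasCompactSupport_testFunction (m N : ℕ) (δ : ℝ) {R : ℝ} (hR : 0 < R) :
    HasCompactSupport (testFunction m N δ R : EuclideanSpace ℝ (Fin n) → ℝ) := by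
  refine HasCompactSupport.intro (isCompact_closedBall 0 (2 * R)) fun x hx => ?_
  rw [mem_closedBall_zero_iff, not_le] at hx
  rw [testFunction, ramp_of_nonpos, mul_zero]
  rw [sub_nonpos, le_div_iff₀ hR]
  exact hx.le

lemma tsupport_testFunction_subset (m N : ℕ) {η δ : ℝ} (R : ℝ) (hδ : 0 < δ) (hηδ : η < δ) :
    tsupport (testFunction m N δ R : EuclideanSpace ℝ (Fin n) → ℝ) ⊆ (Kcone n m η)ᶜ := by
  have h : tsupport (testFunction m N δ R : EuclideanSpace ℝ (Fin n) → ℝ) ⊆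
      {x | δ ≤ coneRatio m x} := by
    refine closure_minimal (fun x hx => ?_) (isClosed_le continuous_const (continuous_coneRatio m))
    by_contra hlt
    refine hx ?_
    rw [testFunction, dyadicCutoff_of_le hδ (not_le.1 hlt).le, zero_mul]
  intro x hx hK
  exact (hηδ.trans_le (h hx)).not_ge (mem_Kcone_iff.1 hK)

/-- A ball on which every test function equals `1`. -/
def plateau (i : Fin n) : Set (EuclideanSpace ℝ (Fin n)) :=
  ball (EuclideanSpace.single i (7 / 8 : ℝ)) (1 / 8)

lemma testFunction_eq_one {m N : ℕ} {δ R : ℝ} (hδ : 0 < δ) (hN : N ≠ 0)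
    (hNδ : 2 ^ N * δ ≤ 3 / 4) (hR : 1 ≤ R) {i : Fin n} (hi : m ≤ i)
    {x : EuclideanSpace ℝ (Fin n)} (hx : x ∈ plateau i) : testFunction m N δ R x = 1 := by
  rw [plateau, mem_ball, dist_eq_norm] at hx
  have hnorm : ‖x‖ ≤ 1 := by
    have h := norm_le_norm_add_norm_sub' x (EuclideanSpace.single i (7 / 8 : ℝ))
    rw [PiLp.norm_single, Real.norm_eq_abs, abs_of_pos (by norm_num)] at h
    linarith
  have hcoord : 3 / 4 ≤ |x i| := by
    have h := PiLp.norm_apply_le (x - EuclideanSpace.single i (7 / 8 : ℝ)) i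
    simp only [PiLp.sub_apply, PiLp.single_apply, if_true, Real.norm_eq_abs] at h
    have h1 := (abs_le.1 (h.trans hx.le)).1
    exact le_trans (by linarith) (le_abs_self _)
  have hratio : 2 ^ N * δ ≤ coneRatio m x := by
    rw [coneRatio, max_eq_left hnorm, div_one]
    exact hNδ.trans (hcoord.trans (abs_apply_le_ybarNorm x hi))
  rw [testFunction, dyadicCutoff_of_ge hN hδ hratio, ramp_of_one_le, mul_one]
  have : ‖x‖ / R ≤ 1 := div_le_one_of_le₀ (hnorm.trans hR) (by positivity)
  linarith

lemma continuous_gaussian :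
    Continuous fun x : EuclideanSpace ℝ (Fin n) => Real.exp (-‖x‖ ^ 2 / 4) := by
  fun_prop

lemma integrableOn_gaussian_plateau (i : Fin n) :
    IntegrableOn (fun x : EuclideanSpace ℝ (Fin n) => Real.exp (-‖x‖ ^ 2 / 4)) (plateau i) :=
  (continuous_gaussian.continuousOn.integrableOn_compact
    (isCompact_closedBall _ _)).mono_set ball_subset_closedBall

lemma integral_gaussian_plateau_pos (i : Fin n) :
    0 < ∫ x in plateau i, Real.exp (-‖x‖ ^ 2 / 4) := by
  rw [setIntegral_pos_iff_support_of_nonneg_ae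
    (Eventually.of_forall fun x => (Real.exp_pos _).le) (integrableOn_gaussian_plateau i)]
  have h : Function.support (fun x : EuclideanSpace ℝ (Fin n) => Real.exp (-‖x‖ ^ 2 / 4)) = univ :=
    eq_univ_of_forall fun x => (Real.exp_pos _).ne'
  rw [h, univ_inter]
  exact measure_ball_pos _ _ (by norm_num)

lemma integral_gaussian_plateau_le {m N : ℕ} {δ R : ℝ} (hδ : 0 < δ) (hN : N ≠ 0)
    (hNδ : 2 ^ N * δ ≤ 3 / 4) (hR : 1 ≤ R) {i : Fin n} (hi : m ≤ i) :
    ∫ x in plateau i, Real.exp (-‖x‖ ^ 2 / 4) ≤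
      ∫ x : EuclideanSpace ℝ (Fin n),
        testFunction m N δ R x ^ 2 * Real.exp (-‖x‖ ^ 2 / 4) := by
  have hR0 : 0 < R := one_pos.trans_le hR
  obtain ⟨K, hK⟩ := exists_lipschitzWith_testFunction (n := n) m N hδ hR0
  have hintegrable : Integrable fun x : EuclideanSpace ℝ (Fin n) =>
      testFunction m N δ R x ^ 2 * Real.exp (-‖x‖ ^ 2 / 4) := by
    refine ((hK.continuous.pow 2).mul continuous_gaussian).integrable_of_hasCompactSupport ?_
    refine (hasCompactSupport_testFunction m N δ hR0).mono fun x hx h0 => hx ?_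
    simp [h0]
  refine le_trans (le_of_eq (setIntegral_congr_fun measurableSet_ball fun x hx => ?_))
    (setIntegral_le_integral hintegrable (Eventually.of_forall fun x => by positivity))
  simp [testFunction_eq_one hδ hN hNδ hR hi hx]

lemma sInf_rayleighSet_le {m : ℕ} {η ρ : ℝ} (h : ρ ∈ rayleighSet n m η) :
    sInf (rayleighSet n m η) ≤ ρ := by
  refine csInf_le ⟨0, ?_⟩ h
  rintro _ ⟨v, -, -, -, -, rfl⟩
  exact div_nonneg (integral_nonneg fun x => by positivity)
    (integral_nonneg fun x => by positivity)

lemma exists_sInf_rayleighSet_le {m : ℕ} (hm : m + 2 ≤ n) :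
    ∃ A > (0 : ℝ), ∀ (η R : ℝ) (N : ℕ), 0 < η → N ≠ 0 → 2 ^ N * η ≤ 1 / 2 → 1 ≤ R →
      sInf (rayleighSet n m η) ≤ A * ((R⁻¹) ^ 2 +
        ((N : ℝ)⁻¹) ^ 2 * ∑ j ∈ Finset.range N, (2 ^ j * (3 / 2 * η)) ^ (n - m - 2)) := by
  let i : Fin n := ⟨n - 1, by omega⟩
  have hi : m ≤ (i : ℕ) := by simp only [i]; omega
  have hD := integral_gaussian_plateau_pos i
  have hG := gaussConst_pos n
  refine ⟨16 * 2 ^ n * gaussConst n * Real.pi ^ n / ∫ x in plateau i, Real.exp (-‖x‖ ^ 2 / 4),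
    by positivity, fun η R N hη hN hNη hR => ?_⟩
  have hδ : 0 < 3 / 2 * η := by positivity
  have hNδ : 2 ^ N * (3 / 2 * η) ≤ 3 / 4 := by linarith
  have hR0 : 0 < R := one_pos.trans_le hR
  have hden := integral_gaussian_plateau_le hδ hN hNδ hR hi
  have hcenter : (EuclideanSpace.single i (7 / 8 : ℝ)) ∈ plateau i :=
    mem_ball_self (by norm_num)
  refine (sInf_rayleighSet_le ⟨testFunction m N (3 / 2 * η) R,
    exists_lipschitzWith_testFunction m N hδ hR0, hasCompactSupport_testFunction m N _ hR0,
    tsupport_testFunction_subset m N R hδ (by linarith), fun h0 => ?_, rfl⟩).trans ?_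
  · have h1 := testFunction_eq_one hδ hN hNδ hR hi hcenter
    rw [h0] at h1
    exact zero_ne_one h1
  · exact (div_le_div₀ (by positivity) (energy_le hm N hδ hR0) hD hden).trans_eq
      (div_mul_eq_mul_div _ _ _).symm

end

lemma exists_dyadic_scale_count {η : ℝ} (hη : η ∈ Set.Ioo (0 : ℝ) (1 / 4)) :
    ∃ N : ℕ, N ≠ 0 ∧ 2 ^ N * η ≤ 1 / 2 ∧ |Real.log η| ≤ 4 * N := by
  obtain ⟨hη0, hη1⟩ := hη
  have hx : 2 < 1 / (2 * η) := by rw [lt_div_iff₀ (by positivity)]; linarith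
  obtain ⟨N, hN, hN'⟩ := exists_nat_pow_near (by linarith : 1 ≤ 1 / (2 * η)) (one_lt_two (α := ℝ))
  have hN0 : N ≠ 0 := by
    rintro rfl
    norm_num at hN'
    norm_num at hx
    linarith
  refine ⟨N, hN0, ?_, ?_⟩
  · rw [le_div_iff₀ (by positivity)] at hN
    linarith
  · rw [abs_of_neg (Real.log_neg hη0 (by linarith)), ← Real.log_inv]
    have hbound : η⁻¹ ≤ (2 ^ (N + 1)) ^ 2 := by
      have h1 : (1 / (2 * η)) ^ 2 ≤ (2 ^ (N + 1)) ^ 2 := by gcongr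
      refine le_trans ?_ h1
      rw [div_pow, one_pow, mul_pow, inv_eq_one_div]
      refine one_div_le_one_div_of_le (by positivity) ?_
      nlinarith
    have hlog := Real.log_le_log (by positivity) hbound
    rw [Real.log_pow, Real.log_pow] at hlog
    push_cast at hlog
    have hN1 : (1 : ℝ) ≤ N := by exact_mod_cast Nat.one_le_iff_ne_zero.2 hN0
    have hlog2 : Real.log 2 ≤ 1 := by linarith [Real.log_two_lt_d9]
    nlinarith

/-- **Proposition 5.1, Step 2 (eigenvalue estimate).** The first Dirichlet eigenvalue of the
Ornstein–Uhlenbeck operator on the complement of the cone `K_η`, characterized as the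
infimum of the Gaussian Rayleigh quotient over Lipschitz functions compactly supported in
`ℝⁿ ∖ K_η`, is at most `C|log η|⁻¹` if `m = n-2` and at most `C η^{n-m-2}` if `m < n-2`,
with `C` depending only on `n` and `m`. -/
theorem OU_eigenvalue_upper_bound
    (n m : ℕ) (hn : 2 ≤ n) (hm : m ≤ n - 2) :
    ∃ C > (0:ℝ), ∀ η ∈ Set.Ioo (0:ℝ) (1/4),
      sInf (rayleighSet n m η) ≤
        if m = n - 2 then C * |Real.log η|⁻¹ else C * η ^ (n - m - 2) := by
  obtain ⟨A, hA, hbound⟩ := exists_sInf_rayleighSet_le (n := n) (m := m) (by omega)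
  by_cases hmn : m = n - 2
  · simp only [if_pos hmn]
    refine ⟨8 * A, by positivity, fun η hη => ?_⟩
    obtain ⟨N, hN, hNη, hlog⟩ := exists_dyadic_scale_count hη
    have hN1 : (1 : ℝ) ≤ N := by exact_mod_cast Nat.one_le_iff_ne_zero.2 hN
    have hlog0 : 0 < |Real.log η| :=
      abs_pos.2 (Real.log_neg hη.1 (hη.2.trans (by norm_num))).ne
    refine (hbound η N N hη.1 hN hNη hN1).trans ?_
    have hexp : n - m - 2 = 0 := by omega
    simp only [hexp, pow_zero, Finset.sum_const, Finset.card_range, nsmul_one]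
    have hinv : (N : ℝ)⁻¹ ≤ 4 * |Real.log η|⁻¹ := by
      rw [inv_le_comm₀ (by positivity) (by positivity), mul_inv, inv_inv]
      linarith
    have hsq : ((N : ℝ)⁻¹) ^ 2 ≤ (N : ℝ)⁻¹ :=
      pow_le_of_le_one (by positivity) (inv_le_one_of_one_le₀ hN1) two_ne_zero
    have hmul : ((N : ℝ)⁻¹) ^ 2 * N = (N : ℝ)⁻¹ := by field_simp
    rw [hmul]
    nlinarith
  · simp only [if_neg hmn]
    refine ⟨A * (1 + (3 / 2) ^ (n - m - 2)), by positivity, fun η hη => ?_⟩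
    obtain ⟨hη0, hη1⟩ := hη
    have hpow : 0 < η ^ (n - m - 2) := by positivity
    have hpow1 : η ^ (n - m - 2) ≤ 1 := pow_le_one₀ hη0.le (by linarith)
    refine (hbound η (η ^ (n - m - 2))⁻¹ 1 hη0 one_ne_zero (by linarith)
      (one_le_inv_iff₀.2 ⟨hpow, hpow1⟩)).trans ?_
    rw [mul_assoc]
    refine mul_le_mul_of_nonneg_left ?_ hA.le
    simp only [inv_inv, Finset.range_one, Finset.sum_singleton, pow_zero, one_mul, mul_pow,
      Nat.cast_one, inv_one, one_pow, add_mul]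
    gcongr
    exact pow_le_of_le_one hpow.le hpow1 two_ne_zero

end
end
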